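/- arXiv:2404.15092 — 9 statements merged into one kernel-verified Lean document; each statement's English description precedes it below -/
import Mathlib

section
/- For all real ν > 0 and r > 0, the surface-area integral of a four-dimensional uniaxial hyperellipsoid of revolution satisfies 4π · ∫_{−νr}^{νr} (r² − z²/ν²) · √( (ν⁴r² + z²(1−ν²)) / (ν²(ν²r² − z²)) ) dz = 2π² ν² r³ · ₂F₁(5/2, 1/2, 2; 1−ν²). -/
open Real

/-- Gauss hypergeometric function via Euler's integral (valid for `0 < b < c`, `z < 1`). -/
noncomputable def twoF1 (a b c z : ℝ) : ℝ :=
  Real.Gamma c / (Real.Gamma b * Real.Gamma (c - b)) *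
    ∫ t in (0:ℝ)..1, t ^ (b - 1) * (1 - t) ^ (c - b - 1) * (1 - z * t) ^ (-a)

open MeasureTheory Set

/-- The integral of an even function over `[-a, a]` is twice its integral over `(0, a)`;
no integrability is needed. -/
theorem intervalIntegral_neg_self_of_even {f : ℝ → ℝ} (hf : ∀ x, f (-x) = f x) {a : ℝ}
    (ha : 0 ≤ a) : ∫ x in (-a)..a, f x = 2 * ∫ x in Ioo 0 a, f x := by
  have habs (x : ℝ) : f |x| = f x := by
    rcases abs_choice x with h | h <;> rw [h]
    exact hf x
  have key := integral_comp_abs (f := (Iio a).indicator f)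
  rw [setIntegral_indicator measurableSet_Iio, Ioi_inter_Iio] at key
  rw [intervalIntegral.integral_of_le (by linarith), integral_Ioc_eq_integral_Ioo,
    ← integral_indicator measurableSet_Ioo, ← key]
  congr 1 with x
  simp only [indicator, mem_Ioo, mem_Iio, abs_lt, habs]

theorem twoF1_five_half_half_two (m : ℝ) :
    twoF1 (5 / 2) (1 / 2) 2 m =
      2 / π * ∫ t in Ioo (0 : ℝ) 1,
        t ^ (-(1 / 2) : ℝ) * (1 - t) ^ (1 / 2 : ℝ) * (1 - m * t) ^ (-(5 / 2) : ℝ) := by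
  have hG : Real.Gamma (2 - 1 / 2) = √π / 2 := by
    rw [show (2 - 1 / 2 : ℝ) = 1 / 2 + 1 by norm_num, Real.Gamma_add_one (by norm_num),
      Real.Gamma_one_half_eq]
    ring
  have hc : Real.Gamma 2 / (Real.Gamma (1 / 2) * Real.Gamma (2 - 1 / 2)) = 2 / π := by
    rw [hG, Real.Gamma_one_half_eq, Real.Gamma_two, mul_div_assoc', mul_self_sqrt pi_pos.le]
    field_simp
  rw [twoF1, hc, intervalIntegral.integral_of_le zero_le_one, integral_Ioc_eq_integral_Ioo]
  norm_num

theorem one_sub_mul_pos {ν t : ℝ} (hν : 0 < ν) (ht : t ∈ Ioo (0 : ℝ) 1) :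
    0 < 1 - (1 - ν ^ 2) * t := by
  nlinarith [mul_pos (pow_pos hν 2) ht.1, ht.2]

theorem hasDerivAt_sqrt_div_one_sub_mul {m t : ℝ} (ht : 0 < t) (hD : 0 < 1 - m * t) (c : ℝ) :
    HasDerivAt (fun t ↦ c * √(t / (1 - m * t)))
      (c / (2 * (1 - m * t) ^ 2 * √(t / (1 - m * t)))) t := by
  have hden : HasDerivAt (fun t : ℝ ↦ 1 - m * t) (-m) t := by
    simpa using ((hasDerivAt_id t).const_mul m).const_sub 1
  have hquot := (hasDerivAt_id t).div hden hD.ne'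
  have h := (hquot.sqrt (div_pos ht hD).ne').const_mul c
  refine h.congr_deriv ?_
  have hq : √(t / (1 - m * t)) ≠ 0 := (sqrt_pos.2 (div_pos ht hD)).ne'
  simp only [Pi.div_apply, id]
  field_simp
  ring

theorem image_sqrt_div_one_sub_mul {ν r : ℝ} (hν : 0 < ν) (hr : 0 < r) :
    (fun t ↦ ν ^ 2 * r * √(t / (1 - (1 - ν ^ 2) * t))) '' Ioo 0 1 = Ioo 0 (ν * r) := by
  have hν2 := pow_pos hν 2
  have hr2 := pow_pos hr 2
  ext z
  constructor
  · rintro ⟨t, ht, rfl⟩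
    have hD := one_sub_mul_pos hν ht
    have hq := div_pos ht.1 hD
    refine ⟨by positivity, ?_⟩
    refine lt_of_pow_lt_pow_left₀ 2 (by positivity) ?_
    rw [mul_pow, sq_sqrt hq.le, mul_div_assoc', div_lt_iff₀ hD]
    have : 0 < ν ^ 2 * r ^ 2 * (1 - t) := mul_pos (by positivity) (by linarith [ht.2])
    nlinarith
  · rintro ⟨hz, hz'⟩
    have hz2 : 0 < z ^ 2 := by positivity
    have hlt : z ^ 2 < ν ^ 2 * r ^ 2 := by rw [← mul_pow]; gcongr
    have hE : 0 < ν ^ 4 * r ^ 2 + z ^ 2 * (1 - ν ^ 2) := by nlinarith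
    refine ⟨z ^ 2 / (ν ^ 4 * r ^ 2 + z ^ 2 * (1 - ν ^ 2)), ⟨by positivity, ?_⟩, ?_⟩
    · rw [div_lt_one hE]
      nlinarith
    · have : z ^ 2 / (ν ^ 4 * r ^ 2 + z ^ 2 * (1 - ν ^ 2)) /
          (1 - (1 - ν ^ 2) * (z ^ 2 / (ν ^ 4 * r ^ 2 + z ^ 2 * (1 - ν ^ 2)))) =
          (z / (ν ^ 2 * r)) ^ 2 := by
        have hd : 1 - (1 - ν ^ 2) * (z ^ 2 / (ν ^ 4 * r ^ 2 + z ^ 2 * (1 - ν ^ 2))) =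
            ν ^ 4 * r ^ 2 / (ν ^ 4 * r ^ 2 + z ^ 2 * (1 - ν ^ 2)) := by
          rw [eq_div_iff hE.ne', sub_mul, mul_assoc, div_mul_cancel₀ _ hE.ne']
          ring
        rw [hd, div_div_div_cancel_right₀ hE.ne', div_pow]
        ring
      simp only [this]
      rw [sqrt_sq (by positivity)]
      field_simp

theorem injOn_sqrt_div_one_sub_mul {ν r : ℝ} (hν : 0 < ν) (hr : 0 < r) :
    InjOn (fun t ↦ ν ^ 2 * r * √(t / (1 - (1 - ν ^ 2) * t))) (Ioo 0 1) := by
  intro s hs t ht hst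
  have hDs := one_sub_mul_pos hν hs
  have hDt := one_sub_mul_pos hν ht
  have h := mul_left_cancel₀ (by positivity) hst
  rw [sqrt_inj (div_pos hs.1 hDs).le (div_pos ht.1 hDt).le, div_eq_div_iff hDs.ne' hDt.ne'] at h
  linarith

theorem surface_integrand_comp_mul_deriv {ν r t : ℝ} (hν : 0 < ν) (hr : 0 < r)
    (ht : t ∈ Ioo (0 : ℝ) 1) {z : ℝ} (hz : z = ν ^ 2 * r * √(t / (1 - (1 - ν ^ 2) * t))) :
    |ν ^ 2 * r / (2 * (1 - (1 - ν ^ 2) * t) ^ 2 * √(t / (1 - (1 - ν ^ 2) * t)))| •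
      ((r ^ 2 - z ^ 2 / ν ^ 2) *
        √((ν ^ 4 * r ^ 2 + z ^ 2 * (1 - ν ^ 2)) / (ν ^ 2 * (ν ^ 2 * r ^ 2 - z ^ 2)))) =
    ν ^ 2 * r ^ 3 / 2 *
      (t ^ (-(1 / 2) : ℝ) * (1 - t) ^ (1 / 2 : ℝ) *
        (1 - (1 - ν ^ 2) * t) ^ (-(5 / 2) : ℝ)) := by
  have hD := one_sub_mul_pos hν ht
  have ht0 := ht.1
  have ht1 : 0 < 1 - t := sub_pos.2 ht.2
  have hz2 : z ^ 2 = ν ^ 4 * r ^ 2 * t / (1 - (1 - ν ^ 2) * t) := by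
    rw [hz, mul_pow, sq_sqrt (by positivity)]
    ring
  have hDt : 1 - (1 - ν ^ 2) * t - ν ^ 2 * t = 1 - t := by ring
  generalize hDdef : 1 - (1 - ν ^ 2) * t = D at *
  have hfac : r ^ 2 - z ^ 2 / ν ^ 2 = r ^ 2 * (1 - t) / D := by
    rw [hz2, ← hDt]
    field_simp
  have hnum : ν ^ 4 * r ^ 2 + z ^ 2 * (1 - ν ^ 2) = ν ^ 4 * r ^ 2 / D := by
    rw [hz2]
    field_simp
    linarith
  have hden : ν ^ 2 * (ν ^ 2 * r ^ 2 - z ^ 2) = ν ^ 4 * r ^ 2 * (1 - t) / D := by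
    rw [hz2, ← hDt]
    field_simp
  have hrat : ν ^ 4 * r ^ 2 / D / (ν ^ 4 * r ^ 2 * (1 - t) / D) = (1 - t)⁻¹ := by
    field_simp
  have hD52 : D ^ (-(5 / 2) : ℝ) = √D / D ^ 3 := by
    rw [sqrt_eq_rpow, ← rpow_natCast D 3, ← rpow_sub hD]
    norm_num
  rw [smul_eq_mul, abs_of_pos (by positivity), hfac, hnum, hden, hrat, hD52, rpow_neg ht0.le,
    ← sqrt_eq_rpow, ← sqrt_eq_rpow, sqrt_inv, sqrt_div ht0.le]
  have hs : √(1 - t) ^ 2 = 1 - t := sq_sqrt ht1.le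
  have hs0 : √(1 - t) ≠ 0 := (sqrt_pos.2 ht1).ne'
  have hD0 : √D ≠ 0 := (sqrt_pos.2 hD).ne'
  have ht0' : √t ≠ 0 := (sqrt_pos.2 ht0).ne'
  field_simp
  rw [hs]

/-- Surface area of a four-dimensional uniaxial hyperellipsoid of revolution. -/
theorem hyperellipsoid_surface_area (ν r : ℝ) (hν : 0 < ν) (hr : 0 < r) :
    4 * π * ∫ z in (-(ν * r))..(ν * r),
        (r ^ 2 - z ^ 2 / ν ^ 2) *
          Real.sqrt ((ν ^ 4 * r ^ 2 + z ^ 2 * (1 - ν ^ 2)) / (ν ^ 2 * (ν ^ 2 * r ^ 2 - z ^ 2)))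
      = 2 * π ^ 2 * ν ^ 2 * r ^ 3 * twoF1 (5 / 2) (1 / 2) 2 (1 - ν ^ 2) := by
  rw [intervalIntegral_neg_self_of_even (fun z ↦ by rw [neg_sq]) (mul_pos hν hr).le,
    ← image_sqrt_div_one_sub_mul hν hr,
    integral_image_eq_integral_abs_deriv_smul measurableSet_Ioo
      (fun t ht ↦ (hasDerivAt_sqrt_div_one_sub_mul ht.1
        (one_sub_mul_pos hν ht) (ν ^ 2 * r)).hasDerivWithinAt)
      (injOn_sqrt_div_one_sub_mul hν hr),
    setIntegral_congr_fun measurableSet_Ioo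
      (fun t ht ↦ surface_integrand_comp_mul_deriv hν hr ht rfl),
    integral_const_mul, twoF1_five_half_half_two]
  generalize (∫ t in Ioo (0 : ℝ) 1, t ^ (-(1 / 2) : ℝ) * (1 - t) ^ (1 / 2 : ℝ) *
    (1 - (1 - ν ^ 2) * t) ^ (-(5 / 2) : ℝ)) = I
  field_simp
  ring
end

section
/- For all real ν > 0 and r > 0, the second-quermassintegral integral of a four-dimensional uniaxial hyperellipsoid of revolution satisfies (π/(3ν³)) · ∫_{−νr}^{νr} √(ν²r² − z²) · [ν⁴r²/(ν⁴r² + z²(1−ν²)) + 2ν²] dz = (π² r²/3) · (ν² + ν + 1)/(ν + 1). -/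
open Real

lemma hasDerivAt_sqrt_sq_sub_sq {a z : ℝ} (h : 0 < a ^ 2 - z ^ 2) :
    HasDerivAt (fun x => √(a ^ 2 - x ^ 2)) (-z / √(a ^ 2 - z ^ 2)) z := by
  have := (((hasDerivAt_id z).pow 2).const_sub (a ^ 2)).sqrt h.ne'
  refine this.congr_deriv ?_
  have := sqrt_pos.2 h
  simp only [id, Pi.pow_apply]
  field_simp
  norm_num

lemma hasDerivAt_arcsin_div {a z : ℝ} (ha : 0 < a) (h : 0 < a ^ 2 - z ^ 2) :
    HasDerivAt (fun x => arcsin (x / a)) (1 / √(a ^ 2 - z ^ 2)) z := by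
  have hlt : |z / a| < 1 := by
    rw [abs_div, abs_of_pos ha, div_lt_one ha]
    exact abs_lt_of_sq_lt_sq (by linarith) ha.le
  have hsqrt : √(1 - (z / a) ^ 2) = √(a ^ 2 - z ^ 2) / a := by
    rw [show 1 - (z / a) ^ 2 = (a ^ 2 - z ^ 2) / a ^ 2 by field_simp, sqrt_div h.le,
      sqrt_sq ha.le]
  have := (hasDerivAt_arcsin (abs_lt.1 hlt).1.ne' (abs_lt.1 hlt).2.ne).comp z
    ((hasDerivAt_id z).div_const a)
  refine this.congr_deriv ?_
  have := sqrt_pos.2 h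
  simp only [hsqrt]
  field_simp

lemma sq_sub_sq_pos_of_mem_Ioo {a z : ℝ} (hz : z ∈ Set.Ioo (-a) a) : 0 < a ^ 2 - z ^ 2 := by
  nlinarith [hz.1, hz.2]

lemma integral_sqrt_sq_sub_sq {a : ℝ} (ha : 0 < a) :
    ∫ z in (-a)..a, √(a ^ 2 - z ^ 2) = π * a ^ 2 / 2 := by
  rw [intervalIntegral.integral_eq_sub_of_hasDerivAt_of_le
    (f := fun z => z * √(a ^ 2 - z ^ 2) / 2 + a ^ 2 / 2 * arcsin (z / a)) (by linarith)]
  · simp only [neg_div, div_self ha.ne', arcsin_neg, arcsin_one, neg_sq, sub_self, sqrt_zero]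
    ring
  · have := continuous_arcsin
    fun_prop
  · intro z hz
    have h := sq_sub_sq_pos_of_mem_Ioo hz
    refine ((((hasDerivAt_id z).mul (hasDerivAt_sqrt_sq_sub_sq h)).div_const 2).add
      ((hasDerivAt_arcsin_div ha h).const_mul (a ^ 2 / 2))).congr_deriv ?_
    have hw := sqrt_pos.2 h
    have hw2 := sq_sqrt h.le
    simp only [id]
    field_simp
    linear_combination -hw2
  · exact Continuous.intervalIntegrable (by fun_prop) _ _

lemma sq_mul_sq_add_sq_mul_pos {a ν z : ℝ} (ha : 0 < a) (hν : 0 < ν)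
    (hz : z ∈ Set.Icc (-a) a) : 0 < ν ^ 2 * a ^ 2 + z ^ 2 * (1 - ν ^ 2) := by
  have h : 0 ≤ a ^ 2 - z ^ 2 := by nlinarith [hz.1, hz.2]
  rcases eq_or_ne z 0 with rfl | hz0
  · simp; positivity
  · have : 0 < z ^ 2 := by positivity
    nlinarith [mul_nonneg (sq_nonneg ν) h]

lemma mul_sq_add_mul_sq_pos {a ν z : ℝ} (ha : 0 < a) (hν : 0 < ν)
    (hz : z ∈ Set.Icc (-a) a) : 0 < ν * a ^ 2 + (1 - ν) * z ^ 2 := by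
  have h : 0 ≤ a ^ 2 - z ^ 2 := by nlinarith [hz.1, hz.2]
  rcases eq_or_ne z 0 with rfl | hz0
  · simp; positivity
  · have : 0 < z ^ 2 := by positivity
    nlinarith [mul_nonneg hν.le h]

lemma continuousOn_sqrt_mul_div {a ν : ℝ} (ha : 0 < a) (hν : 0 < ν) :
    ContinuousOn (fun z => √(a ^ 2 - z ^ 2) *
      (ν ^ 2 * a ^ 2 / (ν ^ 2 * a ^ 2 + z ^ 2 * (1 - ν ^ 2)))) (Set.Icc (-a) a) := by
  refine ContinuousOn.mul (by fun_prop) (ContinuousOn.div (by fun_prop) (by fun_prop) ?_)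
  exact fun z hz => (sq_mul_sq_add_sq_mul_pos ha hν hz).ne'

lemma intervalIntegrable_sqrt_mul_div {a ν : ℝ} (ha : 0 < a) (hν : 0 < ν) :
    IntervalIntegrable (fun z => √(a ^ 2 - z ^ 2) *
      (ν ^ 2 * a ^ 2 / (ν ^ 2 * a ^ 2 + z ^ 2 * (1 - ν ^ 2)))) MeasureTheory.volume (-a) a :=
  (continuousOn_sqrt_mul_div ha hν).intervalIntegrable_of_Icc (by linarith)

lemma integral_sqrt_mul_div {a ν : ℝ} (ha : 0 < a) (hν : 0 < ν) :
    ∫ z in (-a)..a, √(a ^ 2 - z ^ 2) *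
      (ν ^ 2 * a ^ 2 / (ν ^ 2 * a ^ 2 + z ^ 2 * (1 - ν ^ 2))) = π * a ^ 2 * ν / (1 + ν) := by
  rcases eq_or_ne ν 1 with rfl | hν1
  · have : a ^ 2 ≠ 0 := by positivity
    simp only [one_pow, one_mul, sub_self, mul_zero, add_zero, div_self this, mul_one,
      integral_sqrt_sq_sub_sq ha]
    norm_num
  have h1 : 1 - ν ≠ 0 := sub_ne_zero.2 hν1.symm
  rw [intervalIntegral.integral_eq_sub_of_hasDerivAt_of_le
    (f := fun z => a ^ 2 * ν / (1 + ν) * (arcsin (z / a) +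
      arctan ((1 - ν) * (z * √(a ^ 2 - z ^ 2) / (ν * a ^ 2 + (1 - ν) * z ^ 2))) / (1 - ν)))
    (by linarith)]
  · simp only [neg_div, div_self ha.ne', arcsin_neg, arcsin_one, neg_sq, sub_self, sqrt_zero,
      mul_zero, zero_div, arctan_zero]
    ring
  · have := continuous_arcsin
    have := continuous_arctan
    have hq : ContinuousOn (fun z => z * √(a ^ 2 - z ^ 2) / (ν * a ^ 2 + (1 - ν) * z ^ 2))
        (Set.Icc (-a) a) :=
      ContinuousOn.div (by fun_prop) (by fun_prop)
        fun z hz => (mul_sq_add_mul_sq_pos ha hν hz).ne'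
    fun_prop
  · intro z hz
    have h := sq_sub_sq_pos_of_mem_Ioo hz
    have hE := mul_sq_add_mul_sq_pos ha hν (Set.Ioo_subset_Icc_self hz)
    have hD := sq_mul_sq_add_sq_mul_pos ha hν (Set.Ioo_subset_Icc_self hz)
    have hdE : HasDerivAt (fun x => ν * a ^ 2 + (1 - ν) * x ^ 2) ((1 - ν) * (2 * z)) z := by
      simpa using ((hasDerivAt_pow 2 z).const_mul (1 - ν)).const_add (ν * a ^ 2)
    refine (((hasDerivAt_arcsin_div ha h).add
      (((((hasDerivAt_id z).mul (hasDerivAt_sqrt_sq_sub_sq h)).div hdE hE.ne').const_mul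
        (1 - ν)).arctan.div_const (1 - ν))).const_mul (a ^ 2 * ν / (1 + ν))).congr_deriv ?_
    have hw := sqrt_pos.2 h
    have hw2 := sq_sqrt h.le
    simp only [id, Pi.mul_apply, Pi.div_apply]
    set w := √(a ^ 2 - z ^ 2)
    set E := ν * a ^ 2 + (1 - ν) * z ^ 2 with hEdef
    set D := ν ^ 2 * a ^ 2 + z ^ 2 * (1 - ν ^ 2) with hDdef
    have hden : 1 + ((1 - ν) * (z * w / E)) ^ 2 = a ^ 2 * D / E ^ 2 := by
      field_simp
      rw [hEdef, hDdef]
      linear_combination (z ^ 2 * (1 - ν) ^ 2) * hw2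
    rw [hden]
    field_simp
    rw [hEdef, hDdef]
    have ha2 : a ^ 2 = w ^ 2 + z ^ 2 := by linarith
    rw [ha2]
    ring
  · exact intervalIntegrable_sqrt_mul_div ha hν

/-- Second quermassintegral of a four-dimensional uniaxial hyperellipsoid of revolution. -/
theorem hyperellipsoid_W2 (ν r : ℝ) (hν : 0 < ν) (hr : 0 < r) :
    (π / (3 * ν ^ 3)) * ∫ z in (-(ν * r))..(ν * r),
        Real.sqrt (ν ^ 2 * r ^ 2 - z ^ 2) *
          (ν ^ 4 * r ^ 2 / (ν ^ 4 * r ^ 2 + z ^ 2 * (1 - ν ^ 2)) + 2 * ν ^ 2)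
      = (π ^ 2 * r ^ 2 / 3) * ((ν ^ 2 + ν + 1) / (ν + 1)) := by
  have ha : 0 < ν * r := mul_pos hν hr
  have hsq : ν ^ 2 * r ^ 2 = (ν * r) ^ 2 := by ring
  have hfour : ν ^ 4 * r ^ 2 = ν ^ 2 * (ν * r) ^ 2 := by ring
  simp only [hsq, hfour, mul_add]
  rw [intervalIntegral.integral_add (intervalIntegrable_sqrt_mul_div ha hν)
    (Continuous.intervalIntegrable (by fun_prop) _ _), integral_sqrt_mul_div ha hν,
    intervalIntegral.integral_mul_const, integral_sqrt_sq_sub_sq ha]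
  field_simp
  ring
end

section
/- For all real ν > 0 and r > 0, the mean-radius-of-curvature integral of a four-dimensional uniaxial hyperellipsoid of revolution satisfies (2/(3πν³)) · ∫_{−νr}^{νr} √(ν²r² − z²) · (2ν⁶r² + ν⁴[ν⁴r² + z²(1−ν²)]) / (ν⁴r² + z²(1−ν²))^{3/2} dz = ν⁴ r · ₂F₁(5/2, 3/2, 2; 1−ν²). -/
open Real

open Set MeasureTheory

theorem one_sub_mul_one_sub_sq_pos {k s : ℝ} (hk : k < 1) (hs : s ∈ Icc (-1 : ℝ) 1) :
    0 < 1 - k * (1 - s ^ 2) := by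
  have hw : s ^ 2 ≤ 1 := by nlinarith [hs.1, hs.2]
  rcases hw.eq_or_lt with h | h
  · rw [h]; norm_num
  · nlinarith [sq_nonneg s, mul_pos (sub_pos.2 hk) (sub_pos.2 h)]

theorem continuousOn_sqrt_mul_rpow {k : ℝ} (hk : k < 1) (p : ℝ) :
    ContinuousOn (fun s : ℝ => √(1 - s ^ 2) * (1 - k * (1 - s ^ 2)) ^ p) (Icc (-1) 1) :=
  ContinuousOn.mul (by fun_prop) <|
    ContinuousOn.rpow_const (by fun_prop) fun _ hs => Or.inl (one_sub_mul_one_sub_sq_pos hk hs).ne'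

theorem intervalIntegrable_sqrt_mul_rpow {k : ℝ} (hk : k < 1) (p : ℝ) {a b : ℝ}
    (ha : a ∈ Icc (-1 : ℝ) 1) (hb : b ∈ Icc (-1 : ℝ) 1) :
    IntervalIntegrable (fun s : ℝ => √(1 - s ^ 2) * (1 - k * (1 - s ^ 2)) ^ p) volume a b :=
  ((continuousOn_sqrt_mul_rpow hk p).mono
    ((convex_Icc (-1 : ℝ) 1).ordConnected.uIcc_subset ha hb)).intervalIntegrable

theorem rpow_three_halves_eq_mul_sqrt {x : ℝ} (hx : 0 ≤ x) : x ^ (3 / 2 : ℝ) = x * √x := by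
  rw [sqrt_eq_rpow, show (3 / 2 : ℝ) = 1 + 1 / 2 by norm_num,
    rpow_add_of_nonneg hx (by norm_num) (by norm_num), rpow_one]

theorem rpow_neg_three_halves_eq_mul {x : ℝ} (hx : 0 ≤ x) :
    x ^ (-(3 / 2) : ℝ) = x * x ^ (-(5 / 2) : ℝ) := by
  rw [← rpow_one_add' hx (by norm_num)]; norm_num

theorem hasDerivAt_mul_rpow_mul_rpow {k s : ℝ} (hk : k < 1) (hs : s ∈ Icc (-1 : ℝ) 1) :
    HasDerivAt (fun s : ℝ => s * (1 - s ^ 2) ^ (3 / 2 : ℝ) * (1 - k * (1 - s ^ 2)) ^ (-(3 / 2) : ℝ))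
      ((-3 + 4 * (1 - s ^ 2) - k * (1 - s ^ 2) ^ 2) *
        (√(1 - s ^ 2) * (1 - k * (1 - s ^ 2)) ^ (-(5 / 2) : ℝ))) s := by
  have hE := one_sub_mul_one_sub_sq_pos hk hs
  have hw : 0 ≤ 1 - s ^ 2 := by nlinarith [hs.1, hs.2]
  have h1 : HasDerivAt (fun s : ℝ => 1 - s ^ 2) (-(2 * s)) s := by
    simpa using (hasDerivAt_pow 2 s).const_sub 1
  have h2 : HasDerivAt (fun s : ℝ => 1 - k * (1 - s ^ 2)) (-(k * -(2 * s))) s :=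
    (h1.const_mul k).const_sub 1
  refine (((hasDerivAt_id' s).fun_mul (h1.rpow_const (p := (3 / 2 : ℝ)) (Or.inr (by norm_num)))).fun_mul
    (h2.rpow_const (p := (-(3 / 2) : ℝ)) (Or.inl hE.ne'))).congr_deriv ?_
  have e2 : (1 - s ^ 2) ^ (3 / 2 - 1 : ℝ) = √(1 - s ^ 2) := by
    rw [sqrt_eq_rpow]; norm_num
  rw [show (-(3 / 2) - 1 : ℝ) = -(5 / 2) by norm_num, rpow_neg_three_halves_eq_mul hE.le,
    e2, rpow_three_halves_eq_mul_sqrt hw]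
  ring

theorem integral_sqrt_mul_two_add {k : ℝ} (hk : k < 1) :
    ∫ s in (-1 : ℝ)..1, √(1 - s ^ 2) * (2 + (1 - k * (1 - s ^ 2))) /
        (1 - k * (1 - s ^ 2)) ^ (3 / 2 : ℝ)
      = 3 * (1 - k) * ∫ s in (-1 : ℝ)..1, √(1 - s ^ 2) * (1 - k * (1 - s ^ 2)) ^ (-(5 / 2) : ℝ) := by
  have hu : uIcc (-1 : ℝ) 1 = Icc (-1) 1 := uIcc_of_le (by norm_num)
  have hint := intervalIntegrable_sqrt_mul_rpow hk (-(5 / 2)) (a := -1) (b := 1)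
    (by norm_num) (by norm_num)
  have hint' : IntervalIntegrable (fun s : ℝ => (-3 + 4 * (1 - s ^ 2) - k * (1 - s ^ 2) ^ 2) *
      (√(1 - s ^ 2) * (1 - k * (1 - s ^ 2)) ^ (-(5 / 2) : ℝ))) volume (-1) 1 :=
    hint.continuousOn_mul (by fun_prop)
  have hzero := intervalIntegral.integral_eq_sub_of_hasDerivAt
    (fun s hs => hasDerivAt_mul_rpow_mul_rpow hk (hu ▸ hs)) hint'
  norm_num at hzero
  have hcongr : ∀ s ∈ uIcc (-1 : ℝ) 1, √(1 - s ^ 2) * (2 + (1 - k * (1 - s ^ 2))) /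
        (1 - k * (1 - s ^ 2)) ^ (3 / 2 : ℝ)
      = 3 * (1 - k) * (√(1 - s ^ 2) * (1 - k * (1 - s ^ 2)) ^ (-(5 / 2) : ℝ)) -
        k * ((-3 + 4 * (1 - s ^ 2) - k * (1 - s ^ 2) ^ 2) *
          (√(1 - s ^ 2) * (1 - k * (1 - s ^ 2)) ^ (-(5 / 2) : ℝ))) := by
    intro s hs
    have hE := one_sub_mul_one_sub_sq_pos hk (hu ▸ hs)
    rw [div_eq_mul_inv, ← rpow_neg hE.le, rpow_neg_three_halves_eq_mul hE.le]
    ring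
  rw [intervalIntegral.integral_congr hcongr, intervalIntegral.integral_sub (hint.const_mul _)
    (hint'.const_mul _), intervalIntegral.integral_const_mul, intervalIntegral.integral_const_mul]
  norm_num [hzero]

theorem image_one_sub_sq_Ioo : (fun s : ℝ => 1 - s ^ 2) '' Ioo 0 1 = Ioo 0 1 := by
  ext t
  constructor
  · rintro ⟨s, ⟨h0, h1⟩, rfl⟩
    constructor <;> dsimp only <;> nlinarith
  · rintro ⟨h0, h1⟩
    refine ⟨√(1 - t), ⟨sqrt_pos.2 (by linarith), ?_⟩, ?_⟩
    · rw [sqrt_lt' one_pos]; linarith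
    · dsimp only
      rw [sq_sqrt (by linarith)]; ring

theorem twoF1_five_halves_three_halves_two {k : ℝ} (hk : k < 1) :
    twoF1 (5 / 2) (3 / 2) 2 k
      = 2 / π * ∫ s in (-1 : ℝ)..1, √(1 - s ^ 2) * (1 - k * (1 - s ^ 2)) ^ (-(5 / 2) : ℝ) := by
  have hG : Gamma (3 / 2) = √π / 2 := by
    rw [show (3 / 2 : ℝ) = 1 / 2 + 1 by norm_num, Gamma_add_one (by norm_num), Gamma_one_half_eq]
    ring
  have hsub : ∫ t in (0 : ℝ)..1, t ^ ((3 / 2 : ℝ) - 1) * (1 - t) ^ ((2 : ℝ) - 3 / 2 - 1) *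
        (1 - k * t) ^ (-(5 / 2) : ℝ)
      = 2 * ∫ s in (0 : ℝ)..1, √(1 - s ^ 2) * (1 - k * (1 - s ^ 2)) ^ (-(5 / 2) : ℝ) := by
    rw [intervalIntegral.integral_of_le zero_le_one, intervalIntegral.integral_of_le zero_le_one,
      integral_Ioc_eq_integral_Ioo, integral_Ioc_eq_integral_Ioo]
    conv_lhs => rw [← image_one_sub_sq_Ioo]
    rw [integral_image_eq_integral_abs_deriv_smul (f' := fun s => -(2 * s)) measurableSet_Ioo,
      ← integral_const_mul]
    · refine setIntegral_congr_fun measurableSet_Ioo fun s hs => ?_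
      have hs0 : 0 < s := hs.1
      have e : (1 - (1 - s ^ 2)) ^ ((2 : ℝ) - 3 / 2 - 1) = s⁻¹ := by
        rw [sub_sub_cancel, ← rpow_natCast, ← rpow_mul hs0.le, ← rpow_neg_one]; norm_num
      rw [e, abs_neg, abs_of_pos (by positivity), sqrt_eq_rpow, smul_eq_mul,
        show (3 / 2 - 1 : ℝ) = 1 / 2 by norm_num]
      field_simp
    · intro s _
      simpa using ((hasDerivAt_pow 2 s).const_sub 1).hasDerivWithinAt
    · intro a ha b hb hab
      have : a ^ 2 = b ^ 2 := by dsimp only at hab; linarith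
      exact (pow_left_inj₀ ha.1.le hb.1.le two_ne_zero).1 this
  have heven : ∫ s in (-1 : ℝ)..0, √(1 - s ^ 2) * (1 - k * (1 - s ^ 2)) ^ (-(5 / 2) : ℝ)
      = ∫ s in (0 : ℝ)..1, √(1 - s ^ 2) * (1 - k * (1 - s ^ 2)) ^ (-(5 / 2) : ℝ) := by
    have := intervalIntegral.integral_comp_neg (a := 0) (b := 1)
      (fun s : ℝ => √(1 - s ^ 2) * (1 - k * (1 - s ^ 2)) ^ (-(5 / 2) : ℝ))
    simpa using this.symm
  rw [← intervalIntegral.integral_add_adjacent_intervals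
    (intervalIntegrable_sqrt_mul_rpow hk _ (by norm_num) (by norm_num : (0 : ℝ) ∈ Icc (-1) 1))
    (intervalIntegrable_sqrt_mul_rpow hk _ (by norm_num) (by norm_num)), heven, twoF1, hsub, hG,
    show (2 - 3 / 2 : ℝ) = 1 / 2 by norm_num, Gamma_one_half_eq, Gamma_two]
  have : √π / 2 * √π = π / 2 := by
    rw [div_mul_eq_mul_div, mul_self_sqrt pi_pos.le]
  rw [this, ← two_mul]
  generalize (∫ s in (0 : ℝ)..1, √(1 - s ^ 2) * (1 - k * (1 - s ^ 2)) ^ (-(5 / 2) : ℝ)) = I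
  field_simp

/-- Mean radius of curvature of a four-dimensional uniaxial hyperellipsoid of revolution. -/
theorem hyperellipsoid_mean_radius (ν r : ℝ) (hν : 0 < ν) (hr : 0 < r) :
    (2 / (3 * π * ν ^ 3)) * ∫ z in (-(ν * r))..(ν * r),
        Real.sqrt (ν ^ 2 * r ^ 2 - z ^ 2) *
          (2 * ν ^ 6 * r ^ 2 + ν ^ 4 * (ν ^ 4 * r ^ 2 + z ^ 2 * (1 - ν ^ 2))) /
            (ν ^ 4 * r ^ 2 + z ^ 2 * (1 - ν ^ 2)) ^ ((3 : ℝ) / 2)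
      = ν ^ 4 * r * twoF1 (5 / 2) (3 / 2) 2 (1 - ν ^ 2) := by
  have hk : 1 - ν ^ 2 < 1 := by have := pow_pos hν 2; linarith
  have hc : 0 < ν * r := mul_pos hν hr
  rw [show -(ν * r) = ν * r * (-1) by ring]
  nth_rw 2 [show ν * r = ν * r * 1 by ring]
  rw [← intervalIntegral.mul_integral_comp_mul_left]
  have hcongr : ∀ s ∈ uIcc (-1 : ℝ) 1, √(ν ^ 2 * r ^ 2 - (ν * r * s) ^ 2) *
          (2 * ν ^ 6 * r ^ 2 + ν ^ 4 * (ν ^ 4 * r ^ 2 + (ν * r * s) ^ 2 * (1 - ν ^ 2))) /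
            (ν ^ 4 * r ^ 2 + (ν * r * s) ^ 2 * (1 - ν ^ 2)) ^ ((3 : ℝ) / 2)
      = ν ^ 4 * (√(1 - s ^ 2) * (2 + (1 - (1 - ν ^ 2) * (1 - s ^ 2))) /
        (1 - (1 - ν ^ 2) * (1 - s ^ 2)) ^ (3 / 2 : ℝ)) := by
    intro s hs
    rw [uIcc_of_le (by norm_num)] at hs
    have hE := one_sub_mul_one_sub_sq_pos hk hs
    have e1 : ν ^ 2 * r ^ 2 - (ν * r * s) ^ 2 = (ν * r) ^ 2 * (1 - s ^ 2) := by ring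
    have e2 : ν ^ 4 * r ^ 2 + (ν * r * s) ^ 2 * (1 - ν ^ 2)
        = (ν * r) ^ 2 * (1 - (1 - ν ^ 2) * (1 - s ^ 2)) := by ring
    have e3 : ((ν * r) ^ 2) ^ (3 / 2 : ℝ) = (ν * r) ^ 3 := by
      rw [rpow_three_halves_eq_mul_sqrt (by positivity), sqrt_sq hc.le]; ring
    rw [e1, e2, mul_rpow (by positivity) hE.le, e3, sqrt_mul (by positivity), sqrt_sq hc.le]
    have := (rpow_pos_of_pos hE (3 / 2)).ne'
    generalize (1 - (1 - ν ^ 2) * (1 - s ^ 2)) ^ (3 / 2 : ℝ) = F at *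
    field_simp
  rw [intervalIntegral.integral_congr hcongr, intervalIntegral.integral_const_mul,
    integral_sqrt_mul_two_add hk, twoF1_five_halves_three_halves_two hk]
  field_simp
  ring
end

section
/- For every real r > 0, the surface area of a four-dimensional hyperellipsoid of revolution tends to that of a spherical hyperplate as the aspect ratio vanishes: lim_{ν→0⁺} 2π² ν² r³ · ₂F₁(5/2, 1/2, 2; 1−ν²) = (8/3)π r³. -/
open Real

open MeasureTheory Set Filter Topology

theorem image_div_add_Ioi {m : ℝ} (hm : 0 < m) :
    (fun x : ℝ => x / (m + x)) '' Ioi 0 = Ioo 0 1 := by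
  ext t
  constructor
  · rintro ⟨x, hx, rfl⟩
    have hx : 0 < x := hx
    refine ⟨by positivity, ?_⟩
    rw [div_lt_one (by positivity)]
    linarith
  · rintro ⟨h0, h1⟩
    have h : 0 < 1 - t := by linarith
    refine ⟨m * t / (1 - t), div_pos (mul_pos hm h0) h, ?_⟩
    have h2 : m + m * t / (1 - t) = m / (1 - t) := by field_simp; ring
    simp only [h2]
    field_simp

theorem injOn_div_add_Ioi {m : ℝ} (hm : 0 < m) :
    InjOn (fun x : ℝ => x / (m + x)) (Ioi 0) := by
  intro x hx y hy h
  have hx : 0 < x := hx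
  have hy : 0 < y := hy
  have h : x / (m + x) = y / (m + y) := h
  rw [div_eq_div_iff (by positivity) (by positivity)] at h
  have : m * (x - y) = 0 := by linarith
  rcases mul_eq_zero.1 this with h | h <;> linarith

theorem hasDerivAt_div_add {m x : ℝ} (h : m + x ≠ 0) :
    HasDerivAt (fun x : ℝ => x / (m + x)) (m / (m + x) ^ 2) x := by
  refine ((hasDerivAt_id' x).div ((hasDerivAt_id' x).const_add m) h).congr_deriv ?_
  ring

/-- The integrand of the Euler integral after the substitution `t = x / (m + x)`. -/
theorem euler_integrand_comp_div_add {m x : ℝ} (hm : 0 < m) (hx : 0 < x) :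
    m * (m / (m + x) ^ 2 * ((x / (m + x)) ^ ((1 / 2 : ℝ) - 1) *
      (1 - x / (m + x)) ^ ((2 : ℝ) - 1 / 2 - 1) *
      (1 - (1 - m) * (x / (m + x))) ^ (-(5 / 2) : ℝ))) =
    x ^ (-(1 / 2) : ℝ) * (m + x) ^ (1 / 2 : ℝ) * (1 + x) ^ (-(5 / 2) : ℝ) := by
  have hs : 0 < m + x := by positivity
  have e1 : 1 - x / (m + x) = m / (m + x) := by field_simp; ring
  have e2 : 1 - (1 - m) * (x / (m + x)) = m * (1 + x) / (m + x) := by field_simp; ring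
  have hy : 0 < 1 + x := by positivity
  rw [e1, e2, div_rpow hx.le hs.le, div_rpow hm.le hs.le, div_rpow (by positivity) hs.le,
    mul_rpow hm.le hy.le]
  have m1 : m ^ (-(5 / 2) : ℝ) = m ^ (-(1 / 2) : ℝ) / m ^ 2 := by
    rw [← rpow_natCast m 2, ← rpow_sub hm]; norm_num
  have m2 : m ^ (-(1 / 2) : ℝ) = (m ^ (1 / 2 : ℝ))⁻¹ := rpow_neg hm.le _
  have s1 : (m + x) ^ (-(5 / 2) : ℝ) = (m + x) ^ (-(1 / 2) : ℝ) / (m + x) ^ 2 := by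
    rw [← rpow_natCast (m + x) 2, ← rpow_sub hs]; norm_num
  have s2 : (m + x) ^ (-(1 / 2) : ℝ) = ((m + x) ^ (1 / 2 : ℝ))⁻¹ := rpow_neg hs.le _
  have c1 : (1 / 2 : ℝ) - 1 = -(1 / 2) := by norm_num
  have c2 : (2 : ℝ) - 1 / 2 - 1 = 1 / 2 := by norm_num
  rw [c1, c2, m1, m2, s1, s2]
  have := rpow_pos_of_pos hm (1 / 2)
  have := rpow_pos_of_pos hs (1 / 2)
  generalize m ^ (1 / 2 : ℝ) = A at *
  generalize (m + x) ^ (1 / 2 : ℝ) = B at *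
  field_simp

theorem mul_euler_integral_eq {m : ℝ} (hm : 0 < m) :
    m * ∫ t in (0 : ℝ)..1, t ^ ((1 / 2 : ℝ) - 1) * (1 - t) ^ ((2 : ℝ) - 1 / 2 - 1) *
      (1 - (1 - m) * t) ^ (-(5 / 2) : ℝ) =
    ∫ x in Ioi (0 : ℝ),
      x ^ (-(1 / 2) : ℝ) * (m + x) ^ (1 / 2 : ℝ) * (1 + x) ^ (-(5 / 2) : ℝ) := by
  rw [intervalIntegral.integral_of_le zero_le_one, integral_Ioc_eq_integral_Ioo,
    ← image_div_add_Ioi hm, integral_image_eq_integral_abs_deriv_smul measurableSet_Ioi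
      (fun x hx => (hasDerivAt_div_add (add_pos hm hx).ne').hasDerivWithinAt)
      (injOn_div_add_Ioi hm), ← integral_const_mul]
  refine setIntegral_congr_fun measurableSet_Ioi fun x hx => ?_
  have hx : 0 < x := hx
  simp only [smul_eq_mul]
  rw [abs_of_pos (by positivity), euler_integrand_comp_div_add hm hx]

theorem integral_Ioi_one_add_rpow : ∫ x in Ioi (0 : ℝ), (1 + x) ^ (-(5 / 2) : ℝ) = 2 / 3 := by
  have h := integral_Ioi_rpow_of_lt (a := -(5 / 2)) (by norm_num) (c := 1) one_pos
  have h2 := (measurePreserving_add_left volume (1 : ℝ)).setIntegral_preimage_emb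
    (measurableEmbedding_addLeft 1) (fun x : ℝ => x ^ (-(5 / 2) : ℝ)) (Ioi 1)
  rw [h] at h2
  simp only [preimage_const_add_Ioi, sub_self] at h2
  rw [h2]
  norm_num

theorem integrableOn_rpow_mul_one_add_rpow :
    IntegrableOn (fun x : ℝ => x ^ (-(1 / 2) : ℝ) * (1 + x) ^ (-2 : ℝ)) (Ioi 0) := by
  have hmeas : Measurable (fun x : ℝ => x ^ (-(1 / 2) : ℝ) * (1 + x) ^ (-2 : ℝ)) := by fun_prop
  rw [← Ioc_union_Ioi_eq_Ioi zero_le_one, integrableOn_union]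
  constructor
  · have h : IntegrableOn (fun x : ℝ => x ^ (-(1 / 2) : ℝ)) (Ioc 0 1) :=
      (intervalIntegrable_iff_integrableOn_Ioc_of_le zero_le_one).1
        (intervalIntegral.intervalIntegrable_rpow' (by norm_num))
    refine h.mono' hmeas.aestronglyMeasurable
      ((ae_restrict_iff' measurableSet_Ioc).2 (.of_forall fun x hx => ?_))
    have hx0 : 0 < x := hx.1
    rw [norm_of_nonneg (by positivity)]
    exact mul_le_of_le_one_right (by positivity)
      (rpow_le_one_of_one_le_of_nonpos (by linarith) (by norm_num))
  · have h : IntegrableOn (fun x : ℝ => x ^ (-2 : ℝ)) (Ioi 1) :=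
      integrableOn_Ioi_rpow_of_lt (by norm_num) one_pos
    refine h.mono' hmeas.aestronglyMeasurable
      ((ae_restrict_iff' measurableSet_Ioi).2 (.of_forall fun x hx => ?_))
    have hx1 : 1 < x := hx
    have hx0 : 0 < x := by linarith
    rw [norm_of_nonneg (by positivity)]
    calc x ^ (-(1 / 2) : ℝ) * (1 + x) ^ (-2 : ℝ) ≤ 1 * x ^ (-2 : ℝ) := by
          gcongr ?_ * ?_
          · exact rpow_le_one_of_one_le_of_nonpos hx1.le (by norm_num)
          · exact rpow_le_rpow_of_nonpos hx0 (by linarith) (by norm_num)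
      _ = _ := one_mul _

theorem tendsto_integral_rpow_mul_add_rpow :
    Tendsto (fun m : ℝ => ∫ x in Ioi (0 : ℝ),
      x ^ (-(1 / 2) : ℝ) * (m + x) ^ (1 / 2 : ℝ) * (1 + x) ^ (-(5 / 2) : ℝ))
      (𝓝[>] 0) (𝓝 (2 / 3)) := by
  rw [← integral_Ioi_one_add_rpow]
  refine tendsto_integral_filter_of_dominated_convergence
    (fun x : ℝ => x ^ (-(1 / 2) : ℝ) * (1 + x) ^ (-2 : ℝ))
    (.of_forall fun m => Measurable.aestronglyMeasurable (by fun_prop)) ?_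
    integrableOn_rpow_mul_one_add_rpow ?_
  · filter_upwards [Ioo_mem_nhdsGT (zero_lt_one (α := ℝ))] with m hm
    refine (ae_restrict_iff' measurableSet_Ioi).2 (.of_forall fun x hx => ?_)
    have hx0 : 0 < x := hx
    have hm0 : 0 < m := hm.1
    rw [norm_of_nonneg (by positivity), mul_assoc]
    have e : (1 + x) ^ (-2 : ℝ) = (1 + x) ^ (1 / 2 : ℝ) * (1 + x) ^ (-(5 / 2) : ℝ) := by
      rw [← rpow_add (by positivity)]; norm_num
    rw [e]
    have := hm.2.le
    gcongr
  · refine (ae_restrict_iff' measurableSet_Ioi).2 (.of_forall fun x hx => ?_)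
    have hx0 : 0 < x := hx
    have hc : ContinuousAt (fun m : ℝ =>
        x ^ (-(1 / 2) : ℝ) * (m + x) ^ (1 / 2 : ℝ) * (1 + x) ^ (-(5 / 2) : ℝ)) 0 := by
      refine (continuousAt_const.mul ?_).mul continuousAt_const
      exact ContinuousAt.rpow_const (by fun_prop) (.inr (by norm_num))
    have h := hc.tendsto.mono_left (nhdsWithin_le_nhds (s := Ioi 0))
    rwa [zero_add, ← rpow_add hx0, neg_add_cancel, rpow_zero, one_mul] at h

/-- The surface area of a four-dimensional hyperellipsoid of revolution tends to that
of a spherical hyperplate as the aspect ratio vanishes. -/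
theorem hyperellipsoid_surface_area_plate_limit (r : ℝ) (hr : 0 < r) :
    Filter.Tendsto
      (fun ν : ℝ => 2 * π ^ 2 * ν ^ 2 * r ^ 3 * twoF1 (5 / 2) (1 / 2) 2 (1 - ν ^ 2))
      (nhdsWithin 0 (Set.Ioi 0))
      (nhds ((8 / 3) * π * r ^ 3)) := by
  have hsq : Tendsto (fun ν : ℝ => ν ^ 2) (𝓝[>] 0) (𝓝[>] 0) := by
    refine tendsto_nhdsWithin_iff.2 ⟨?_, ?_⟩
    · have h : Tendsto (fun ν : ℝ => ν ^ 2) (𝓝 0) (𝓝 (0 ^ 2)) := (continuous_pow 2).tendsto 0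
      rw [zero_pow two_ne_zero] at h
      exact h.mono_left nhdsWithin_le_nhds
    · filter_upwards [self_mem_nhdsWithin] with ν hν using pow_pos (mem_Ioi.1 hν) 2
  have hΓ : Real.Gamma (2 - 1 / 2) = √π / 2 := by
    rw [show (2 : ℝ) - 1 / 2 = 1 / 2 + 1 by norm_num, Real.Gamma_add_one (by norm_num),
      Real.Gamma_one_half_eq]
    ring
  have hlim := (tendsto_integral_rpow_mul_add_rpow.comp hsq).const_mul (4 * π * r ^ 3)
  rw [show 4 * π * r ^ 3 * (2 / 3) = 8 / 3 * π * r ^ 3 by ring] at hlim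
  refine hlim.congr' ?_
  filter_upwards [self_mem_nhdsWithin] with ν hν
  have hν : 0 < ν := hν
  simp only [Function.comp_apply]
  rw [← mul_euler_integral_eq (pow_pos hν 2), twoF1, hΓ, Real.Gamma_two,
    Real.Gamma_one_half_eq,
    show √π * (√π / 2) = π / 2 by rw [← mul_div_assoc, mul_self_sqrt pi_pos.le]]
  have h (I : ℝ) : 4 * π * r ^ 3 * (ν ^ 2 * I) =
      2 * π ^ 2 * ν ^ 2 * r ^ 3 * (1 / (π / 2) * I) := by
    field_simp
    ring
  exact h _
end

section
/- For all real ν ≥ 1 and r > 0, the volume integral of a four-dimensional hyperspindle satisfies (4/3)π · ∫_{−νr}^{νr} [ ((1−ν²)/2)·r + (1/2)·√((ν²+1)²r² − 4z²) ]³ dz = (5π/16) r⁴ · [ (ν⁴ − (6/5)ν² + 1)(ν²+1)² · arcsin(2ν/(ν²+1)) − 2ν⁷ − (14/15)ν⁵ + (14/15)ν³ + 2ν ]. -/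
open Real

/-- Derivative of an antiderivative of `z ↦ (a + √(R² - z²)) ^ 3`. -/
lemma hasDerivAt_add_sqrt_cube_primitive {a R z : ℝ} (hR : 0 < R) (hz : z ^ 2 < R ^ 2) :
    HasDerivAt (fun z : ℝ => a ^ 3 * z + 3 * a * (R ^ 2 * z - z ^ 3 / 3)
        + z * √(R ^ 2 - z ^ 2) ^ 3 / 4
        + (3 * a ^ 2 + 3 / 4 * R ^ 2) / 2 * (z * √(R ^ 2 - z ^ 2) + R ^ 2 * arcsin (z / R)))
      ((a + √(R ^ 2 - z ^ 2)) ^ 3) z := by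
  have hpos : 0 < R ^ 2 - z ^ 2 := sub_pos.mpr hz
  set w := √(R ^ 2 - z ^ 2) with hw
  have hw0 : 0 < w := Real.sqrt_pos.mpr hpos
  have hw2 : w ^ 2 = R ^ 2 - z ^ 2 := Real.sq_sqrt hpos.le
  have habs : |z| < R := abs_lt_of_sq_lt_sq hz hR.le
  have hlt := abs_lt.mp habs
  have hsqrt : HasDerivAt (fun z : ℝ => √(R ^ 2 - z ^ 2)) (-z / w) z := by
    refine (((hasDerivAt_pow 2 z).const_sub (R ^ 2)).sqrt hpos.ne').congr_deriv ?_
    rw [← hw]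
    field_simp
    ring
  have harcsin : HasDerivAt (fun z : ℝ => arcsin (z / R)) (1 / w) z := by
    have h₁ : z / R ≠ -1 := by
      rw [Ne, div_eq_iff hR.ne']
      linarith
    have h₂ : z / R ≠ 1 := by
      rw [Ne, div_eq_iff hR.ne']
      linarith
    have hs : √(1 - (z / R) ^ 2) = w / R := by
      rw [show 1 - (z / R) ^ 2 = (w / R) ^ 2 by rw [div_pow, div_pow, hw2]; field_simp]
      exact Real.sqrt_sq (by positivity)
    refine ((Real.hasDerivAt_arcsin h₁ h₂).comp z
      ((hasDerivAt_id z).div_const R)).congr_deriv ?_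
    rw [hs]
    field_simp
  refine (((((hasDerivAt_id z).const_mul (a ^ 3)).add
    ((((hasDerivAt_id z).const_mul (R ^ 2)).sub ((hasDerivAt_pow 3 z).div_const 3)).const_mul
      (3 * a))).add (((hasDerivAt_id z).mul (hsqrt.pow 3)).div_const 4)).add
    ((((hasDerivAt_id z).mul hsqrt).add (harcsin.const_mul (R ^ 2))).const_mul
      ((3 * a ^ 2 + 3 / 4 * R ^ 2) / 2))).congr_deriv ?_
  simp only [id, Pi.pow_apply, ← hw]
  have hR2 : R ^ 2 = w ^ 2 + z ^ 2 := by linarith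
  rw [hR2]
  field_simp
  ring

lemma integral_add_sqrt_cube {a R b : ℝ} (hR : 0 < R) (hb : 0 ≤ b) (hbR : b ≤ R) :
    ∫ z in (-b)..b, (a + √(R ^ 2 - z ^ 2)) ^ 3 =
      2 * (a ^ 3 * b + 3 * a * (R ^ 2 * b - b ^ 3 / 3) + b * √(R ^ 2 - b ^ 2) ^ 3 / 4
        + (3 * a ^ 2 + 3 / 4 * R ^ 2) / 2 *
          (b * √(R ^ 2 - b ^ 2) + R ^ 2 * arcsin (b / R))) := by
  rw [intervalIntegral.integral_eq_sub_of_hasDerivAt_of_le (by linarith)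
    (Continuous.continuousOn (by
      have := Real.continuous_arcsin
      fun_prop))
    (fun z hz => hasDerivAt_add_sqrt_cube_primitive (a := a) hR
      (sq_lt_sq' (by linarith [hz.1]) (by linarith [hz.2])))
    (Continuous.intervalIntegrable (by fun_prop) _ _)]
  rw [neg_div, Real.arcsin_neg, neg_sq]
  ring

/-- Volume of a four-dimensional hyperspindle with equatorial radius `r` and
aspect ratio `ν ≥ 1`. -/
theorem hyperspindle_volume (ν r : ℝ) (hν : 1 ≤ ν) (hr : 0 < r) :
    (4 / 3) * π * ∫ z in (-(ν * r))..(ν * r),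
        (((1 - ν ^ 2) / 2) * r + (1 / 2) * Real.sqrt ((ν ^ 2 + 1) ^ 2 * r ^ 2 - 4 * z ^ 2)) ^ 3
      = (5 * π / 16) * r ^ 4 *
          ((ν ^ 4 - (6 / 5) * ν ^ 2 + 1) * (ν ^ 2 + 1) ^ 2 * Real.arcsin (2 * ν / (ν ^ 2 + 1))
            - 2 * ν ^ 7 - (14 / 15) * ν ^ 5 + (14 / 15) * ν ^ 3 + 2 * ν) := by
  have hscale (z : ℝ) : (1 / 2) * √((ν ^ 2 + 1) ^ 2 * r ^ 2 - 4 * z ^ 2)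
      = √(((ν ^ 2 + 1) / 2 * r) ^ 2 - z ^ 2) := by
    rw [show (ν ^ 2 + 1) ^ 2 * r ^ 2 - 4 * z ^ 2
        = 2 ^ 2 * (((ν ^ 2 + 1) / 2 * r) ^ 2 - z ^ 2) by ring,
      Real.sqrt_mul (by norm_num), Real.sqrt_sq (by norm_num)]
    ring
  have hend : √(((ν ^ 2 + 1) / 2 * r) ^ 2 - (ν * r) ^ 2) = (ν ^ 2 - 1) / 2 * r := by
    rw [show ((ν ^ 2 + 1) / 2 * r) ^ 2 - (ν * r) ^ 2 = ((ν ^ 2 - 1) / 2 * r) ^ 2 by ring]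
    exact Real.sqrt_sq (mul_nonneg (by nlinarith) hr.le)
  have harg : ν * r / ((ν ^ 2 + 1) / 2 * r) = 2 * ν / (ν ^ 2 + 1) := by
    field_simp
  simp only [hscale]
  rw [integral_add_sqrt_cube (by positivity) (by positivity)
    (mul_le_mul_of_nonneg_right (by nlinarith [sq_nonneg (ν - 1)]) hr.le), hend, harg]
  ring
end

section
/- For all real ν ≥ 1 and r > 0, the surface-area integral of a four-dimensional hyperspindle satisfies 4π · ∫_{−νr}^{νr} r(z)² · √(1 + ṙ(z)²) dz = (π r³/2) · [ (3ν⁶ + ν⁴ + ν² + 3) · arcsin(2ν/(ν²+1)) − 6ν⁵ + 6ν ], where r(z) = ((1−ν²)/2)·r + (1/2)·√((ν²+1)²r² − 4z²) and ṙ(z) = −2z/√((ν²+1)²r² − 4z²). -/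
open Real

/-- An antiderivative of the area density of a spindle whose meridian is an arc of a circle of
radius `R` with centre at height `c`. -/
lemma hasDerivAt_spindle_primitive {R c z : ℝ} (hR : 0 < R) (hz : z ^ 2 < R ^ 2) :
    HasDerivAt (fun z => R * ((c ^ 2 + R ^ 2 / 2) * arcsin (z / R) + 2 * c * z
        + z * √(R ^ 2 - z ^ 2) / 2))
      ((c + √(R ^ 2 - z ^ 2)) ^ 2 * (R / √(R ^ 2 - z ^ 2))) z := by
  have hlt := abs_lt_of_sq_lt_sq' hz hR.le
  have hpos : 0 < R ^ 2 - z ^ 2 := by linarith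
  have hw : 0 < √(R ^ 2 - z ^ 2) := sqrt_pos.mpr hpos
  have hw2 : √(R ^ 2 - z ^ 2) ^ 2 = R ^ 2 - z ^ 2 := sq_sqrt hpos.le
  have h1 : z / R ≠ -1 := by
    intro h
    rw [div_eq_iff hR.ne'] at h
    linarith [hlt.1]
  have h2 : z / R ≠ 1 := by
    intro h
    rw [div_eq_iff hR.ne'] at h
    linarith [hlt.2]
  have hsqrt : √(1 - (z / R) ^ 2) = √(R ^ 2 - z ^ 2) / R := by
    rw [show 1 - (z / R) ^ 2 = (R ^ 2 - z ^ 2) / R ^ 2 by field_simp, sqrt_div hpos.le,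
      sqrt_sq hR.le]
  have ha := (hasDerivAt_arcsin h1 h2).comp z ((hasDerivAt_id z).div_const R)
  have hs : HasDerivAt (fun z : ℝ => √(R ^ 2 - z ^ 2)) (-(2 * z) / (2 * √(R ^ 2 - z ^ 2))) z := by
    have h := ((hasDerivAt_pow 2 z).const_sub (R ^ 2)).sqrt hpos.ne'
    simpa using h
  have h := (((ha.const_mul (c ^ 2 + R ^ 2 / 2)).add ((hasDerivAt_id z).const_mul (2 * c))).add
    (((hasDerivAt_id z).mul hs).div_const 2)).const_mul R
  refine h.congr_deriv ?_
  simp only [id]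
  rw [hsqrt]
  generalize √(R ^ 2 - z ^ 2) = w at hw hw2
  field_simp
  linear_combination (-1 : ℝ) * hw2

/-- The area density of a spindle integrates to the increment of its antiderivative, also when the
meridian has vertical tangents at the endpoints. -/
lemma integral_spindle_density {R c a : ℝ} (hR : 0 < R) (ha : 0 ≤ a) (haR : a ≤ R) :
    ∫ z in (-a)..a, (c + √(R ^ 2 - z ^ 2)) ^ 2 * (R / √(R ^ 2 - z ^ 2))
      = R * ((2 * c ^ 2 + R ^ 2) * arcsin (a / R) + 4 * c * a + a * √(R ^ 2 - a ^ 2)) := by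
  have hle : -a ≤ a := by linarith
  have hcont : ContinuousOn (fun z => R * ((c ^ 2 + R ^ 2 / 2) * arcsin (z / R) + 2 * c * z
      + z * √(R ^ 2 - z ^ 2) / 2)) (Set.Icc (-a) a) := by
    have := continuous_arcsin.comp (continuous_id.div_const R)
    exact Continuous.continuousOn (by fun_prop)
  have hderiv : ∀ z ∈ Set.Ioo (-a) a, HasDerivAt
      (fun z => R * ((c ^ 2 + R ^ 2 / 2) * arcsin (z / R) + 2 * c * z
        + z * √(R ^ 2 - z ^ 2) / 2))
      ((c + √(R ^ 2 - z ^ 2)) ^ 2 * (R / √(R ^ 2 - z ^ 2))) z := fun z hz =>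
    hasDerivAt_spindle_primitive hR (by nlinarith [hz.1, hz.2])
  have hint : IntervalIntegrable (fun z => (c + √(R ^ 2 - z ^ 2)) ^ 2 * (R / √(R ^ 2 - z ^ 2)))
      MeasureTheory.volume (-a) a := by
    refine intervalIntegral.intervalIntegrable_deriv_of_nonneg
      (by rwa [Set.uIcc_of_le hle]) ?_ (fun z _ => by positivity)
    rwa [min_eq_left hle, max_eq_right hle]
  rw [intervalIntegral.integral_eq_sub_of_hasDerivAt_of_le hle hcont hderiv hint, neg_div,
    arcsin_neg, neg_sq]
  ring

/-- The arc length factor of a circle of radius `R`, in a form free of the derivative. -/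
lemma sqrt_one_add_deriv_circle_sq {R z w : ℝ} (hR : 0 < R) (hw : 0 < w)
    (h : w ^ 2 = R ^ 2 - z ^ 2) :
    √(1 + (-(2 * z) / (2 * w)) ^ 2) = R / w := by
  rw [show 1 + (-(2 * z) / (2 * w)) ^ 2 = (R / w) ^ 2 by field_simp; linarith]
  exact sqrt_sq (by positivity)

/-- Surface area of a four-dimensional hyperspindle with equatorial radius `r` and
aspect ratio `ν ≥ 1`, with meridian curve
`r(z) = ((1−ν²)/2)·r + (1/2)·√((ν²+1)²r² − 4z²)` and derivative
`ṙ(z) = −2z/√((ν²+1)²r² − 4z²)`. -/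
theorem hyperspindle_surface_area (ν r : ℝ) (hν : 1 ≤ ν) (hr : 0 < r) :
    4 * π * ∫ z in (-(ν * r))..(ν * r),
        (((1 - ν ^ 2) / 2) * r + (1 / 2) * Real.sqrt ((ν ^ 2 + 1) ^ 2 * r ^ 2 - 4 * z ^ 2)) ^ 2 *
          Real.sqrt (1 + (-(2 * z) / Real.sqrt ((ν ^ 2 + 1) ^ 2 * r ^ 2 - 4 * z ^ 2)) ^ 2)
      = (π * r ^ 3 / 2) *
          ((3 * ν ^ 6 + ν ^ 4 + ν ^ 2 + 3) * Real.arcsin (2 * ν / (ν ^ 2 + 1))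
            - 6 * ν ^ 5 + 6 * ν) := by
  set R := (ν ^ 2 + 1) * r / 2 with hRdef
  set c := (1 - ν ^ 2) / 2 * r with hcdef
  have hR : 0 < R := by positivity
  have ha : 0 ≤ ν * r := by positivity
  have haR : ν * r ≤ R := by nlinarith [mul_nonneg (sq_nonneg (ν - 1)) hr.le]
  have hsq (z : ℝ) : √((ν ^ 2 + 1) ^ 2 * r ^ 2 - 4 * z ^ 2) = 2 * √(R ^ 2 - z ^ 2) := by
    rw [show (ν ^ 2 + 1) ^ 2 * r ^ 2 - 4 * z ^ 2 = 2 ^ 2 * (R ^ 2 - z ^ 2) by rw [hRdef]; ring,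
      sqrt_mul (by positivity), sqrt_sq (by norm_num)]
  have hcongr : ∫ z in (-(ν * r))..(ν * r),
        (c + 1 / 2 * √((ν ^ 2 + 1) ^ 2 * r ^ 2 - 4 * z ^ 2)) ^ 2 *
          √(1 + (-(2 * z) / √((ν ^ 2 + 1) ^ 2 * r ^ 2 - 4 * z ^ 2)) ^ 2)
      = ∫ z in (-(ν * r))..(ν * r), (c + √(R ^ 2 - z ^ 2)) ^ 2 * (R / √(R ^ 2 - z ^ 2)) := by
    refine intervalIntegral.integral_congr_Ioo_of_le (by linarith) fun z hz => ?_
    have hpos : 0 < R ^ 2 - z ^ 2 := by nlinarith [hz.1, hz.2]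
    simp only [hsq]
    rw [sqrt_one_add_deriv_circle_sq hR (sqrt_pos.mpr hpos) (sq_sqrt hpos.le)]
    ring
  have hend : √(R ^ 2 - (ν * r) ^ 2) = -c := by
    rw [show R ^ 2 - (ν * r) ^ 2 = (-c) ^ 2 by rw [hRdef, hcdef]; ring]
    exact sqrt_sq (by nlinarith [mul_nonneg (mul_nonneg (sub_nonneg.mpr hν) (by linarith :
      (0 : ℝ) ≤ ν + 1)) hr.le])
  have hang : ν * r / R = 2 * ν / (ν ^ 2 + 1) := by
    rw [hRdef]
    field_simp
  rw [hcongr, integral_spindle_density hR ha haR, hend, hang, hRdef, hcdef]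
  ring
end

section
/- For all real ν with 0 < ν ≤ 1 and r > 0, the volume integral of a four-dimensional hyperlens satisfies (4/3)π · ∫_{−νr}^{νr} [ (|z|·r·(ν²−1) + ν·(r² − z²))/ν ]^{3/2} dz = (π r⁴/(32ν⁴)) · { (1+ν²)⁴ · [π − 2·arcsin((1−ν²)/(1+ν²))] − 4ν·[1 − ν⁶ + (11/3)ν²(1−ν²)] }. -/
open Real

/-- An antiderivative of `(R² - u²)^(3/2)` on `(-R, R)`. -/
lemma hasDerivAt_sqrt_sq_sub_sq_cube {R u : ℝ} (hR : 0 < R) (hu : u ∈ Set.Ioo (-R) R) :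
    HasDerivAt (fun u => u * √(R ^ 2 - u ^ 2) ^ 3 / 4 + 3 * R ^ 2 * u * √(R ^ 2 - u ^ 2) / 8
      + 3 * R ^ 4 / 8 * arcsin (u / R)) (√(R ^ 2 - u ^ 2) ^ 3) u := by
  obtain ⟨hl, hr⟩ := hu
  have hpos : 0 < R ^ 2 - u ^ 2 := by nlinarith
  have hs : 0 < √(R ^ 2 - u ^ 2) := sqrt_pos.mpr hpos
  have hsq : √(R ^ 2 - u ^ 2) ^ 2 = R ^ 2 - u ^ 2 := sq_sqrt hpos.le
  have hd := (((hasDerivAt_id' u).pow 2).const_sub (R ^ 2)).sqrt hpos.ne'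
  have ha := (hasDerivAt_arcsin (x := u / R)
    (by rw [ne_eq, div_eq_iff hR.ne']; linarith)
    (by rw [ne_eq, div_eq_iff hR.ne']; linarith)).comp u ((hasDerivAt_id' u).div_const R)
  have hq : √(1 - (u / R) ^ 2) = √(R ^ 2 - u ^ 2) / R := by
    rw [show 1 - (u / R) ^ 2 = (R ^ 2 - u ^ 2) / R ^ 2 by field_simp, sqrt_div hpos.le,
      sqrt_sq hR.le]
  rw [hq] at ha
  refine (((((hasDerivAt_id' u).mul (hd.pow 3)).div_const 4).add
    ((((hasDerivAt_id' u).const_mul (3 * R ^ 2)).mul hd).div_const 8)).add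
    (ha.const_mul (3 * R ^ 4 / 8))).congr_deriv ?_
  simp only [Pi.pow_apply]
  set s := √(R ^ 2 - u ^ 2)
  have hu2 : u ^ 2 = R ^ 2 - s ^ 2 := by linarith
  field_simp
  norm_num
  ring_nf
  simp only [hu2]
  ring

lemma integral_sqrt_sq_sub_sq_cube {R c : ℝ} (hR : 0 < R) (hc : -R ≤ c) (hcR : c ≤ R) :
    ∫ u in c..R, √(R ^ 2 - u ^ 2) ^ 3 = 3 * R ^ 4 / 8 * (π / 2 - arcsin (c / R))
      - c * √(R ^ 2 - c ^ 2) ^ 3 / 4 - 3 * R ^ 2 * c * √(R ^ 2 - c ^ 2) / 8 := by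
  rw [intervalIntegral.integral_eq_sub_of_hasDerivAt_of_le hcR
    (f := fun u => u * √(R ^ 2 - u ^ 2) ^ 3 / 4 + 3 * R ^ 2 * u * √(R ^ 2 - u ^ 2) / 8
      + 3 * R ^ 4 / 8 * arcsin (u / R))
    (by
      have := continuous_arcsin
      exact Continuous.continuousOn (by fun_prop))
    (fun u hu => hasDerivAt_sqrt_sq_sub_sq_cube hR ⟨hc.trans_lt hu.1, hu.2⟩)
    (Continuous.intervalIntegrable (by fun_prop) _ _)]
  simp only [sub_self, sqrt_zero, div_self hR.ne', arcsin_one]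
  ring

lemma intervalIntegral_comp_abs_symm {f : ℝ → ℝ} {a : ℝ} (ha : 0 ≤ a)
    (hf : Continuous fun x => f |x|) :
    ∫ x in (-a)..a, f |x| = 2 * ∫ x in (0 : ℝ)..a, f x := by
  have hpos : ∫ x in (0 : ℝ)..a, f |x| = ∫ x in (0 : ℝ)..a, f x := by
    refine intervalIntegral.integral_congr fun x hx => ?_
    rw [Set.uIcc_of_le ha] at hx
    simp only [abs_of_nonneg hx.1]
  have hneg : ∫ x in (-a)..0, f |x| = ∫ x in (0 : ℝ)..a, f |x| := by
    simpa using (intervalIntegral.integral_comp_neg (fun x => f |x|) (a := -a) (b := 0))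
  rw [← intervalIntegral.integral_add_adjacent_intervals (b := 0)
    (hf.intervalIntegrable _ _) (hf.intervalIntegrable _ _), hneg, hpos]
  ring

/-- Volume of a four-dimensional hyperlens with equatorial radius `r` and
aspect ratio `ν ∈ (0, 1]`. -/
theorem hyperlens_volume (ν r : ℝ) (hν0 : 0 < ν) (hν1 : ν ≤ 1) (hr : 0 < r) :
    (4 / 3) * π * ∫ z in (-(ν * r))..(ν * r),
        ((|z| * r * (ν ^ 2 - 1) + ν * (r ^ 2 - z ^ 2)) / ν) ^ ((3 : ℝ) / 2)
      = (π * r ^ 4 / (32 * ν ^ 4)) *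
          ((1 + ν ^ 2) ^ 4 * (π - 2 * Real.arcsin ((1 - ν ^ 2) / (1 + ν ^ 2)))
            - 4 * ν * (1 - ν ^ 6 + (11 / 3) * ν ^ 2 * (1 - ν ^ 2))) := by
  set c := r * (1 - ν ^ 2) / (2 * ν) with hc
  set R := r * (1 + ν ^ 2) / (2 * ν) with hR
  have hR0 : 0 < R := by positivity
  have hc0 : 0 ≤ c := div_nonneg (mul_nonneg hr.le (by nlinarith)) (by positivity)
  have hcR : c + ν * r = R := by rw [hc, hR]; field_simp; ring
  have hνr : 0 < ν * r := mul_pos hν0 hr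
  have hint : ∫ z in (-(ν * r))..(ν * r),
        ((|z| * r * (ν ^ 2 - 1) + ν * (r ^ 2 - z ^ 2)) / ν) ^ ((3 : ℝ) / 2)
      = ∫ z in (-(ν * r))..(ν * r), √(R ^ 2 - (|z| + c) ^ 2) ^ 3 := by
    refine intervalIntegral.integral_congr fun z hz => ?_
    rw [Set.uIcc_of_le (by linarith), Set.mem_Icc, ← abs_le] at hz
    have hbase : (|z| * r * (ν ^ 2 - 1) + ν * (r ^ 2 - z ^ 2)) / ν
        = R ^ 2 - (|z| + c) ^ 2 := by
      rw [← sq_abs z, hc, hR]; field_simp; ring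
    have hnn : 0 ≤ R ^ 2 - (|z| + c) ^ 2 := by nlinarith [abs_nonneg z]
    simp only [hbase]
    rw [rpow_div_two_eq_sqrt _ hnn]
    exact_mod_cast rpow_natCast _ 3
  have hsqrt : √(R ^ 2 - c ^ 2) = r := by
    rw [show R ^ 2 - c ^ 2 = r ^ 2 by rw [hc, hR]; field_simp; ring, sqrt_sq hr.le]
  have hdiv : c / R = (1 - ν ^ 2) / (1 + ν ^ 2) := by rw [hc, hR]; field_simp
  rw [hint, intervalIntegral_comp_abs_symm (f := fun z => √(R ^ 2 - (z + c) ^ 2) ^ 3) hνr.le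
    (by fun_prop), intervalIntegral.integral_comp_add_right (fun u => √(R ^ 2 - u ^ 2) ^ 3),
    zero_add, add_comm (ν * r), hcR, integral_sqrt_sq_sub_sq_cube hR0 (by linarith)
    (by linarith), hsqrt, hdiv, hc, hR]
  generalize arcsin _ = t
  field_simp
  ring
end

section
/- For all real ν with 0 < ν ≤ 1 and r > 0, the surface-area integral of a four-dimensional hyperlens satisfies 4π · ∫_{−νr}^{νr} r(z)² · √(1 + ṙ(z)²) dz = (π(1+ν²) r³/(4ν³)) · { (1+ν²)² · [π − 2·arcsin((1−ν²)/(1+ν²))] − 4ν(1−ν²) }, where r(z) = √( (|z|·r·(ν²−1) + ν·(r² − z²))/ν ) and ṙ is its derivative on each of the intervals (−νr, 0) and (0, νr). -/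
open Real

/-- The standard antiderivative of `√(R² - u²)` inside `(-R, R)`. -/
theorem hasDerivAt_circle_primitive {R u : ℝ} (hl : -R < u) (hu : u < R) :
    HasDerivAt (fun x : ℝ => (x * √(R ^ 2 - x ^ 2) + R ^ 2 * arcsin (x / R)) / 2)
      (√(R ^ 2 - u ^ 2)) u := by
  have hR : 0 < R := by linarith
  have hpos : 0 < R ^ 2 - u ^ 2 := by nlinarith
  have hs : 0 < √(R ^ 2 - u ^ 2) := sqrt_pos.2 hpos
  have hsq : √(R ^ 2 - u ^ 2) ^ 2 = R ^ 2 - u ^ 2 := sq_sqrt hpos.le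
  have hsqrt : HasDerivAt (fun x : ℝ => √(R ^ 2 - x ^ 2)) (-(2 * u) / (2 * √(R ^ 2 - u ^ 2))) u := by
    have h : HasDerivAt (fun x : ℝ => R ^ 2 - x ^ 2) (-(2 * u)) u := by
      simpa using (hasDerivAt_pow 2 u).const_sub (R ^ 2)
    exact h.sqrt hpos.ne'
  have hasin : HasDerivAt (fun x : ℝ => arcsin (x / R)) (1 / √(R ^ 2 - u ^ 2)) u := by
    have h := (hasDerivAt_arcsin (x := u / R)
      (by rw [ne_eq, div_eq_iff hR.ne']; linarith)
      (by rw [ne_eq, div_eq_iff hR.ne']; linarith)).comp u ((hasDerivAt_id u).div_const R)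
    have e : √(1 - (u / R) ^ 2) = √(R ^ 2 - u ^ 2) / R := by
      rw [show 1 - (u / R) ^ 2 = (R ^ 2 - u ^ 2) / R ^ 2 by field_simp, sqrt_div hpos.le,
        sqrt_sq hR.le]
    refine h.congr_deriv ?_
    rw [e]
    field_simp
  refine ((((hasDerivAt_id u).mul hsqrt).add (hasin.const_mul (R ^ 2))).div_const 2).congr_deriv ?_
  simp only [id]
  field_simp
  linarith

/-- The area under the circular arc of radius `R` over `[c, R]`. -/
theorem integral_sqrt_sq_sub_sq_s15 {R c : ℝ} (hc : -R < c) (hcR : c ≤ R) :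
    ∫ u in c..R, √(R ^ 2 - u ^ 2) =
      (R ^ 2 * (π / 2 - arcsin (c / R)) - c * √(R ^ 2 - c ^ 2)) / 2 := by
  have hR : 0 < R := by linarith
  rw [intervalIntegral.integral_eq_sub_of_hasDerivAt_of_le hcR
    (f := fun x : ℝ => (x * √(R ^ 2 - x ^ 2) + R ^ 2 * arcsin (x / R)) / 2)
    (by fun_prop) (fun u hu => hasDerivAt_circle_primitive (hc.trans hu.1) hu.2)
    (Continuous.intervalIntegrable (by fun_prop) _ _)]
  simp only [div_self hR.ne', arcsin_one, sub_self, sqrt_zero]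
  ring

/-- An integral of a function of `|z|` over a symmetric interval is twice the half integral. -/
theorem intervalIntegral_comp_abs {h : ℝ → ℝ} (hh : Continuous h) {a : ℝ} (ha : 0 ≤ a) :
    ∫ z in -a..a, h |z| = 2 * ∫ z in (0 : ℝ)..a, h z := by
  have hc : Continuous fun z : ℝ => h |z| := hh.comp continuous_abs
  have hpos : ∫ z in (0 : ℝ)..a, h |z| = ∫ z in (0 : ℝ)..a, h z := by
    refine intervalIntegral.integral_congr fun z hz => ?_
    rw [Set.uIcc_of_le ha] at hz
    simp only [abs_of_nonneg hz.1]
  have hneg : ∫ z in -a..0, h |z| = ∫ z in (0 : ℝ)..a, h |z| := by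
    simpa using (intervalIntegral.integral_comp_neg (a := 0) (b := a) fun z => h |z|).symm
  rw [← intervalIntegral.integral_add_adjacent_intervals (hc.intervalIntegrable (-a) 0)
    (hc.intervalIntegrable 0 a), hneg, hpos]
  ring

/-- For a meridian `√(R² - (|w| + c)²)` made of circular arcs of radius `R`, the line element
`√(1 + ṙ²)` is `R / r`. -/
theorem sq_mul_sqrt_one_add_sq_of_hasDerivAt {R c z d : ℝ} (hR : 0 < R) (hz : z ≠ 0)
    (hpos : 0 < R ^ 2 - (|z| + c) ^ 2)
    (hd : HasDerivAt (fun w : ℝ => √(R ^ 2 - (|w| + c) ^ 2)) d z) :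
    (R ^ 2 - (|z| + c) ^ 2) * √(1 + d ^ 2) = R * √(R ^ 2 - (|z| + c) ^ 2) := by
  have hs := sqrt_pos.2 hpos
  have hsq := sq_sqrt hpos.le
  have hd' := ((((hasDerivAt_abs hz).add_const c).pow 2).const_sub (R ^ 2)).sqrt hpos.ne'
  have he := hd.unique hd'
  have hsign : ((SignType.sign z : SignType) : ℝ) ^ 2 = 1 := by
    rcases lt_or_gt_of_ne hz with h | h <;> simp [h]
  have hd2 : 1 + d ^ 2 = (R / √(R ^ 2 - (|z| + c) ^ 2)) ^ 2 := by
    have h : d ^ 2 = (|z| + c) ^ 2 / √(R ^ 2 - (|z| + c) ^ 2) ^ 2 := by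
      rw [he]
      simp only [Pi.pow_apply, Nat.cast_ofNat, Nat.add_one_sub_one, pow_one]
      field_simp
      rw [hsign]
      ring
    rw [h, div_pow, hsq]
    field_simp
    ring
  rw [hd2, sqrt_sq (by positivity)]
  field_simp
  rw [hsq]

/-- Surface area of a four-dimensional hyperlens with equatorial radius `r` and
aspect ratio `ν ∈ (0, 1]`, with meridian curve
`r(z) = √((|z|·r·(ν²−1) + ν·(r² − z²))/ν)` and `ṙ` its derivative on each of the
intervals `(−νr, 0)` and `(0, νr)`. -/
theorem hyperlens_surface_area (ν r : ℝ) (hν0 : 0 < ν) (hν1 : ν ≤ 1) (hr : 0 < r)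
    (rdot : ℝ → ℝ)
    (hrdot : ∀ z ∈ Set.Ioo (-(ν * r)) 0 ∪ Set.Ioo 0 (ν * r),
      HasDerivAt (fun w : ℝ => Real.sqrt ((|w| * r * (ν ^ 2 - 1) + ν * (r ^ 2 - w ^ 2)) / ν))
        (rdot z) z) :
    4 * π * ∫ z in (-(ν * r))..(ν * r),
        ((|z| * r * (ν ^ 2 - 1) + ν * (r ^ 2 - z ^ 2)) / ν) * Real.sqrt (1 + rdot z ^ 2)
      = (π * (1 + ν ^ 2) * r ^ 3 / (4 * ν ^ 3)) *
          ((1 + ν ^ 2) ^ 2 * (π - 2 * Real.arcsin ((1 - ν ^ 2) / (1 + ν ^ 2)))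
            - 4 * ν * (1 - ν ^ 2)) := by
  set R := (1 + ν ^ 2) * r / (2 * ν) with hRdef
  set c := (1 - ν ^ 2) * r / (2 * ν) with hcdef
  have hR : 0 < R := by positivity
  have hc : 0 ≤ c := div_nonneg (mul_nonneg (by nlinarith) hr.le) (by positivity)
  have ha : 0 < ν * r := by positivity
  have hsum : ν * r + c = R := by rw [hRdef, hcdef]; field_simp; ring
  have hcurve : ∀ w : ℝ, (|w| * r * (ν ^ 2 - 1) + ν * (r ^ 2 - w ^ 2)) / ν
      = R ^ 2 - (|w| + c) ^ 2 := by
    intro w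
    rw [← sq_abs w, hRdef, hcdef]
    field_simp
    ring
  simp only [hcurve] at hrdot ⊢
  have hint : ∫ z in (-(ν * r))..(ν * r), (R ^ 2 - (|z| + c) ^ 2) * √(1 + rdot z ^ 2)
      = ∫ z in (-(ν * r))..(ν * r), R * √(R ^ 2 - (|z| + c) ^ 2) := by
    refine intervalIntegral.integral_congr_ae ?_
    filter_upwards [(Set.toFinite {0, ν * r}).countable.ae_notMem MeasureTheory.volume] with z hz hm
    rw [Set.uIoc_of_le (by linarith)] at hm
    simp only [Set.mem_insert_iff, Set.mem_singleton_iff, not_or] at hz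
    have hlt : z < ν * r := lt_of_le_of_ne hm.2 hz.2
    have habs : |z| < ν * r := abs_lt.2 ⟨hm.1, hlt⟩
    refine sq_mul_sqrt_one_add_sq_of_hasDerivAt hR hz.1
      (by nlinarith [abs_nonneg z]) (hrdot z ?_)
    rcases lt_or_gt_of_ne hz.1 with h | h
    · exact Or.inl ⟨hm.1, h⟩
    · exact Or.inr ⟨h, hlt⟩
  have hroot : √(R ^ 2 - c ^ 2) = r := by
    rw [show R ^ 2 - c ^ 2 = r ^ 2 by rw [hRdef, hcdef]; field_simp; ring, sqrt_sq hr.le]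
  have hratio : c / R = (1 - ν ^ 2) / (1 + ν ^ 2) := by
    rw [hRdef, hcdef]
    field_simp
  rw [hint, intervalIntegral.integral_const_mul,
    intervalIntegral_comp_abs (h := fun x => √(R ^ 2 - (x + c) ^ 2)) (by fun_prop) ha.le,
    intervalIntegral.integral_comp_add_right (fun x => √(R ^ 2 - x ^ 2)) c, zero_add, hsum,
    integral_sqrt_sq_sub_sq_s15 (by linarith) (by linarith), hroot, hratio]
  generalize arcsin ((1 - ν ^ 2) / (1 + ν ^ 2)) = θ
  rw [hRdef, hcdef]
  field_simp
  ring
end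

section
/- Let 0 < ν < 1 and r > 0. For ε > 0 small set r_t(ε) := ε·r·(1+ν²)/(2νε + r(1−ν²)), ξ(ε) := −2ε·√(ν(νr−ε)(νε+r)) / (2νε + (1−ν²)r) + √((νr−ε)(νε+r)/ν), and θ_c(ε) := arccos(ε/r_t(ε)). Then the equatorial-singularity contribution of a hyperlens to the second quermassintegral satisfies lim_{ε→0⁺} (π/3) · ∫_{θ_c(ε)}^{π−θ_c(ε)} [ 3 r_t(ε)² sin²θ + 4 r_t(ε) ξ(ε) sinθ + ξ(ε)² ] dθ = (2/3)π r² · arcsin((1−ν²)/(1+ν²)). -/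
open Real

/-- Meridian radius of the hypertorus continuously completing a hyperlens near its
equatorial singularity. -/
noncomputable def rt (ν r ε : ℝ) : ℝ :=
  ε * r * (1 + ν ^ 2) / (2 * ν * ε + r * (1 - ν ^ 2))

/-- Distance between the center of the hypertorus and the center of its meridian arc. -/
noncomputable def ξ (ν r ε : ℝ) : ℝ :=
  -(2 * ε) * Real.sqrt (ν * (ν * r - ε) * (ν * ε + r)) / (2 * ν * ε + (1 - ν ^ 2) * r)
    + Real.sqrt ((ν * r - ε) * (ν * ε + r) / ν)

/-- Angular cutoff of the hypertorus completion: `cos θ_c(ε) = ε / r_t(ε)`. -/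
noncomputable def θc (ν r ε : ℝ) : ℝ := Real.arccos (ε / rt ν r ε)

theorem tendsto_meridian_center (ν r : ℝ) (hν0 : 0 < ν) (hν1 : ν < 1) (hr : 0 < r) :
    Filter.Tendsto (ξ ν r) (nhds 0) (nhds r) := by
  have hden : 2 * ν * 0 + (1 - ν ^ 2) * r ≠ 0 := by
    have : 0 < (1 - ν ^ 2) * r := mul_pos (by nlinarith) hr
    linarith
  have hcont : ContinuousAt (ξ ν r) 0 := by
    unfold ξ
    fun_prop (disch := assumption)
  have hval : ξ ν r 0 = r := by
    have : (ν * r - 0) * (ν * 0 + r) / ν = r ^ 2 := by field_simp; ring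
    simp only [ξ, this, Real.sqrt_sq hr.le]
    simp
  simpa only [hval] using hcont.tendsto

theorem tendsto_meridian_radius (ν r : ℝ) (hν0 : 0 < ν) (hν1 : ν < 1) (hr : 0 < r) :
    Filter.Tendsto (rt ν r) (nhds 0) (nhds 0) := by
  have hden : 2 * ν * 0 + r * (1 - ν ^ 2) ≠ 0 := by
    have : 0 < r * (1 - ν ^ 2) := mul_pos hr (by nlinarith)
    linarith
  have hcont : ContinuousAt (rt ν r) 0 := by
    unfold rt
    fun_prop (disch := assumption)
  simpa [rt] using hcont.tendsto

theorem tendsto_angular_cutoff (ν r : ℝ) (hr : 0 < r) :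
    Filter.Tendsto (θc ν r) (nhdsWithin 0 (Set.Ioi 0))
      (nhds (Real.arccos ((1 - ν ^ 2) / (1 + ν ^ 2)))) := by
  have hcont : Continuous fun ε : ℝ => (2 * ν * ε + r * (1 - ν ^ 2)) / (r * (1 + ν ^ 2)) := by
    fun_prop
  have hval : (2 * ν * 0 + r * (1 - ν ^ 2)) / (r * (1 + ν ^ 2)) = (1 - ν ^ 2) / (1 + ν ^ 2) := by
    rw [mul_zero, zero_add, mul_div_mul_left _ _ hr.ne']
  refine (Real.continuous_arccos.tendsto _).comp ?_
  refine ((hval ▸ hcont.tendsto 0).mono_left nhdsWithin_le_nhds).congr' ?_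
  filter_upwards [self_mem_nhdsWithin] with ε hε
  have hε' : ε ≠ 0 := (Set.mem_Ioi.mp hε).ne'
  rw [rt, div_div_eq_mul_div, mul_assoc ε r, mul_div_mul_left _ _ hε']

theorem integral_meridian_arc (a b t : ℝ) :
    ∫ θ in t..(π - t), 3 * a ^ 2 * Real.sin θ ^ 2 + 4 * a * b * Real.sin θ + b ^ 2
      = 3 * a ^ 2 * (Real.sin t * Real.cos t + (π - 2 * t) / 2)
        + 8 * a * b * Real.cos t + b ^ 2 * (π - 2 * t) := by
  rw [intervalIntegral.integral_add (Continuous.intervalIntegrable (by fun_prop) _ _)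
      (Continuous.intervalIntegrable (by fun_prop) _ _),
    intervalIntegral.integral_add (Continuous.intervalIntegrable (by fun_prop) _ _)
      (Continuous.intervalIntegrable (by fun_prop) _ _),
    intervalIntegral.integral_const_mul, intervalIntegral.integral_const_mul, integral_sin_sq,
    integral_sin, intervalIntegral.integral_const, Real.sin_pi_sub, Real.cos_pi_sub, smul_eq_mul]
  ring

/-- The equatorial-singularity contribution of a four-dimensional hyperlens to its
second quermassintegral: `W₂'' = (2/3)·π·r²·arcsin((1−ν²)/(1+ν²))`. -/
theorem hyperlens_equatorial_singularity_W2 (ν r : ℝ) (hν0 : 0 < ν) (hν1 : ν < 1)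
    (hr : 0 < r) :
    Filter.Tendsto
      (fun ε : ℝ => (π / 3) * ∫ θ in (θc ν r ε)..(π - θc ν r ε),
        3 * rt ν r ε ^ 2 * Real.sin θ ^ 2 + 4 * rt ν r ε * ξ ν r ε * Real.sin θ + ξ ν r ε ^ 2)
      (nhdsWithin 0 (Set.Ioi 0))
      (nhds ((2 / 3) * π * r ^ 2 * Real.arcsin ((1 - ν ^ 2) / (1 + ν ^ 2)))) := by
  simp only [integral_meridian_arc]
  have ha := (tendsto_meridian_radius ν r hν0 hν1 hr).mono_left
    (nhdsWithin_le_nhds (s := Set.Ioi 0))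
  have hb := (tendsto_meridian_center ν r hν0 hν1 hr).mono_left
    (nhdsWithin_le_nhds (s := Set.Ioi 0))
  have ht := tendsto_angular_cutoff ν r hr
  have hF : Continuous fun p : ℝ × ℝ × ℝ =>
      (π / 3) * (3 * p.1 ^ 2 * (Real.sin p.2.2 * Real.cos p.2.2 + (π - 2 * p.2.2) / 2)
        + 8 * p.1 * p.2.1 * Real.cos p.2.2 + p.2.1 ^ 2 * (π - 2 * p.2.2)) := by
    fun_prop
  have hlim := (hF.tendsto _).comp (ha.prodMk_nhds (hb.prodMk_nhds ht))
  simp only [Function.comp_def] at hlim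
  convert hlim using 2
  rw [Real.arccos]
  ring
end
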